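/- arXiv:1210.7736 — 4 statements merged into one kernel-verified Lean document; each statement's English description precedes it below -/
import Mathlib

section
/- Let β : ℝ → ℝ be continuous, let W_C : ℝ → ℝ be continuous with 0 ≤ W_C ≤ 1 and W_C(r) = 1 for all r ≥ 0, let V : ℝ → ℝ be bounded and continuous, let h > 0 and α ≥ 0, and assume α²e^{−2(r+β(r))} ≥ 3 for all r ≤ 0. Define, for u ∈ C_c^∞(ℝ, ℂ), (P(α)u)(r) = −h²u''(r) + (α²e^{−2(r+β(r))} + h²V(r) − 1)u(r) − iW_C(r)u(r). If ε > 0 and λ ∈ ℂ satisfies Im λ − (1/3)Re λ + 2/3 − (1/3)h² sup_ℝ |V| ≥ ε, then for every u ∈ C_c^∞(ℝ, ℂ), ‖u‖_{L²(ℝ)} ≤ (2/ε) ‖(P(α) − λ)u‖_{L²(ℝ)}. (Elliptic-range resolvent estimate for the model operator in the cusp at high angular frequency.) -/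
open MeasureTheory

/-- The pointwise inequality behind the elliptic estimate. Here `u`, `u'`, `u''` stand for the
values of a function and of its first two derivatives, and `A + B - 1 - iW` for the potential. -/
theorem normSq_le_of_elliptic {u u' u'' lam : ℂ} {A B W S h ε : ℝ} (hε : 0 < ε)
    (hAW : 2 ≤ A - 1 + 3 * W) (hB : -S ≤ B)
    (hlam : ε ≤ lam.im - (1 / 3) * lam.re + 2 / 3 - (1 / 3) * S) :
    ‖u‖ ^ 2 ≤ (2 / ε) ^ 2 *
        ‖(-(h ^ 2 : ℂ) * u'' + ((A + B - 1 : ℝ) : ℂ) * u - Complex.I * (W : ℂ) * u) - lam * u‖ ^ 2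
      + 2 * h ^ 2 / ε *
        ((1 / 3 + Complex.I) * (star u' * u' + star u * u'')).re := by
  set f := (-(h ^ 2 : ℂ) * u'' + ((A + B - 1 : ℝ) : ℂ) * u - Complex.I * (W : ℂ) * u) - lam * u
    with hf
  have hre : f.re = -h ^ 2 * u''.re + (A + B - 1) * u.re + W * u.im
      - (lam.re * u.re - lam.im * u.im) := by
    simp [hf, ← Complex.ofReal_pow]
  have him : f.im = -h ^ 2 * u''.im + (A + B - 1) * u.im - W * u.re
      - (lam.re * u.im + lam.im * u.re) := by
    simp [hf, ← Complex.ofReal_pow]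
  have hg : ((1 / 3 + Complex.I) * (star u' * u' + star u * u'')).re =
      1 / 3 * (u'.re ^ 2 + u'.im ^ 2 + (u.re * u''.re + u.im * u''.im))
        - (u.re * u''.im - u.im * u''.re) := by
    simp
    ring
  rw [hg, ← Complex.normSq_eq_norm_sq, ← Complex.normSq_eq_norm_sq, Complex.normSq_apply,
    Complex.normSq_apply]
  clear_value f
  clear hf hg
  set G := 1 / 3 * (u'.re ^ 2 + u'.im ^ 2 + (u.re * u''.re + u.im * u''.im))
        - (u.re * u''.im - u.im * u''.re) with hG
  set N := u.re * u.re + u.im * u.im with hN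
  have hN0 : 0 ≤ N := add_nonneg (mul_self_nonneg _) (mul_self_nonneg _)
  have hid : 1 / 3 * (u.re * f.re + u.im * f.im) - (u.re * f.im - u.im * f.re) =
      -h ^ 2 * G + 1 / 3 * h ^ 2 * (u'.re ^ 2 + u'.im ^ 2)
        + ((A + B - 1 - lam.re) / 3 + W + lam.im) * N := by
    rw [hre, him, hG, hN]
    ring
  have hcoef : ε * N ≤ ((A + B - 1 - lam.re) / 3 + W + lam.im) * N :=
    mul_le_mul_of_nonneg_right (by linarith) hN0
  have hgrad : 0 ≤ 1 / 3 * h ^ 2 * (u'.re ^ 2 + u'.im ^ 2) := by positivity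
  have hamgm : ε * (1 / 3 * (u.re * f.re + u.im * f.im) - (u.re * f.im - u.im * f.re)) ≤
      ε ^ 2 / 2 * N + 2 * (f.re * f.re + f.im * f.im) := by
    rw [hN]
    nlinarith [sq_nonneg (ε * u.re - (f.re / 3 - f.im)), sq_nonneg (ε * u.im - (f.im / 3 + f.re)),
      sq_nonneg f.re, sq_nonneg f.im]
  have hmain : ε ^ 2 * N ≤ 4 * (f.re * f.re + f.im * f.im) + 2 * h ^ 2 * ε * G := by
    have := mul_le_mul_of_nonneg_left hcoef hε.le
    have := mul_nonneg hε.le hgrad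
    rw [hid] at hamgm
    linarith
  have hdiv : (2 / ε) ^ 2 * (f.re * f.re + f.im * f.im) + 2 * h ^ 2 / ε * G =
      (4 * (f.re * f.re + f.im * f.im) + 2 * h ^ 2 * ε * G) / ε ^ 2 := by
    field_simp
    ring
  rw [hdiv, le_div_iff₀ (by positivity)]
  linarith

/-- The derivative of `star u * u'` integrates to zero for compactly supported `u`. -/
theorem integral_deriv_star_mul_deriv {u : ℝ → ℂ} (hu : ContDiff ℝ 2 u)
    (hc : HasCompactSupport u) :
    ∫ r, (star (deriv u r) * deriv u r + star (u r) * deriv (deriv u) r) = 0 := by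
  have hu' : ContDiff ℝ 1 (deriv u) := hu.deriv'
  have hcont := hu.continuous
  have hcont' := hu'.continuous
  have hcont'' := hu'.continuous_deriv le_rfl
  refine integral_eq_zero_of_hasDerivAt_of_integrable
    (f := fun r => star (u r) * deriv u r) (fun r => ?_) ?_ ?_
  · exact ((hu.differentiable (by norm_num) r).hasDerivAt.star).mul
      (hu'.differentiable (by norm_num) r).hasDerivAt
  · refine Continuous.integrable_of_hasCompactSupport (by fun_prop) ?_
    exact (hc.deriv.mul_left).add (hc.deriv.deriv.mul_left)
  · exact Continuous.integrable_of_hasCompactSupport (by fun_prop) hc.deriv.mul_left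

theorem eLpNorm_two_le_of_integral_sq_le {X E F : Type*} [MeasurableSpace X] {μ : Measure X}
    [NormedAddCommGroup E] [NormedAddCommGroup F] {f : X → E} {g : X → F} {C : ℝ} (hC : 0 ≤ C)
    (hf : MemLp f 2 μ) (hg : MemLp g 2 μ)
    (hfg : ∫ x, ‖f x‖ ^ 2 ∂μ ≤ C ^ 2 * ∫ x, ‖g x‖ ^ 2 ∂μ) :
    eLpNorm f 2 μ ≤ ENNReal.ofReal C * eLpNorm g 2 μ := by
  rw [hf.eLpNorm_eq_integral_rpow_norm two_ne_zero ENNReal.ofNat_ne_top,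
    hg.eLpNorm_eq_integral_rpow_norm two_ne_zero ENNReal.ofNat_ne_top, ← ENNReal.ofReal_mul hC]
  refine ENNReal.ofReal_le_ofReal ?_
  simp only [ENNReal.toReal_ofNat, Real.rpow_ofNat, ← one_div, ← Real.sqrt_eq_rpow]
  calc _ ≤ √(C ^ 2 * ∫ x, ‖g x‖ ^ 2 ∂μ) := Real.sqrt_le_sqrt hfg
    _ = _ := by rw [Real.sqrt_mul (sq_nonneg C), Real.sqrt_sq hC]

/-- Elliptic-range resolvent estimate for the cusp model operator
`P(α) = h²D_r² + α²e^{−2(r+β(r))} + h²V(r) − 1 − iW_C(r)` at high angular frequency: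
if `α²e^{−2(r+β(r))} ≥ 3` for `r ≤ 0` and
`Im λ − (1/3)Re λ + 2/3 − (1/3)h² sup|V| ≥ ε`, then
`‖u‖ ≤ (2/ε)‖(P(α) − λ)u‖` for all `u ∈ C_c^∞(ℝ, ℂ)`. -/
theorem cusp_model_elliptic_estimate
    (β W_C V : ℝ → ℝ) (hβ : Continuous β)
    (hWc : Continuous W_C) (hW0 : ∀ r, 0 ≤ W_C r) (hW1 : ∀ r, W_C r ≤ 1)
    (hW_one : ∀ r : ℝ, 0 ≤ r → W_C r = 1)
    (hV : Continuous V) (hVbdd : BddAbove (Set.range fun r => |V r|))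
    (h α : ℝ) (hh : 0 < h) (hα : 0 ≤ α)
    (hbig : ∀ r : ℝ, r ≤ 0 → 3 ≤ α ^ 2 * Real.exp (-2 * (r + β r)))
    (ε : ℝ) (hε : 0 < ε) (lam : ℂ)
    (hlam : ε ≤ lam.im - (1 / 3) * lam.re + 2 / 3 - (1 / 3) * h ^ 2 * (⨆ r : ℝ, |V r|)) :
    ∀ u : ℝ → ℂ, ContDiff ℝ (⊤ : ℕ∞) u → HasCompactSupport u →
      eLpNorm u 2 volume ≤
        ENNReal.ofReal (2 / ε) *
          eLpNorm (fun r =>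
            (-(h ^ 2 : ℂ) * deriv (deriv u) r
              + ((α ^ 2 * Real.exp (-2 * (r + β r)) + h ^ 2 * V r - 1 : ℝ) : ℂ) * u r
              - Complex.I * (W_C r : ℂ) * u r) - lam * u r) 2 volume := by
  intro u hu hc
  have hu2 : ContDiff ℝ 2 u := contDiff_infty.1 hu 2
  have hcont := hu2.continuous
  have hcont' : Continuous (deriv u) := hu2.continuous_deriv (by norm_num)
  have hu' : ContDiff ℝ 1 (deriv u) := hu2.deriv'
  have hcont'' : Continuous (deriv (deriv u)) := hu'.continuous_deriv le_rfl
  set f : ℝ → ℂ := fun r =>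
    (-(h ^ 2 : ℂ) * deriv (deriv u) r
      + ((α ^ 2 * Real.exp (-2 * (r + β r)) + h ^ 2 * V r - 1 : ℝ) : ℂ) * u r
      - Complex.I * (W_C r : ℂ) * u r) - lam * u r with hf
  have hfcont : Continuous f := by fun_prop
  have hfc : HasCompactSupport f :=
    ((hc.deriv.deriv.mul_left.add hc.mul_left).sub hc.mul_left).sub hc.mul_left
  have humem : MemLp u 2 volume := hcont.memLp_of_hasCompactSupport hc
  have hfmem : MemLp f 2 volume := hfcont.memLp_of_hasCompactSupport hfc
  set g : ℝ → ℂ := fun r =>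
    star (deriv u r) * deriv u r + star (u r) * deriv (deriv u) r with hg
  have hgint : Integrable g := Continuous.integrable_of_hasCompactSupport (by fun_prop)
    ((hc.deriv.mul_left).add (hc.deriv.deriv.mul_left))
  have hgzero : ∫ r, ((1 / 3 + Complex.I) * g r).re = 0 := by
    have := integral_re (hgint.const_mul (1 / 3 + Complex.I))
    simp only [RCLike.re_eq_complex_re] at this
    rw [this, integral_const_mul, integral_deriv_star_mul_deriv hu2 hc, mul_zero, Complex.zero_re]
  refine eLpNorm_two_le_of_integral_sq_le (by positivity) humem hfmem ?_
  have hfint := (hfmem.integrable_norm_pow two_ne_zero).const_mul ((2 / ε) ^ 2)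
  have hgreint := ((hgint.const_mul (1 / 3 + Complex.I)).re).const_mul (2 * h ^ 2 / ε)
  simp only [RCLike.re_eq_complex_re] at hgreint
  calc ∫ r, ‖u r‖ ^ 2
      ≤ ∫ r, ((2 / ε) ^ 2 * ‖f r‖ ^ 2 + 2 * h ^ 2 / ε * ((1 / 3 + Complex.I) * g r).re) := by
        refine integral_mono (humem.integrable_norm_pow two_ne_zero) (hfint.add hgreint)
          fun r => normSq_le_of_elliptic (S := h ^ 2 * ⨆ r : ℝ, |V r|) hε ?_ ?_ (by linarith)
        · rcases le_total r 0 with hr | hr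
          · linarith [hbig r hr, hW0 r]
          · have : 0 ≤ α ^ 2 * Real.exp (-2 * (r + β r)) := by positivity
            linarith [hW_one r hr]
        · rw [← mul_neg]
          exact mul_le_mul_of_nonneg_left
            ((neg_le_neg (le_ciSup hVbdd r)).trans (neg_abs_le (V r))) (sq_nonneg h)
    _ = (2 / ε) ^ 2 * ∫ r, ‖f r‖ ^ 2 := by
        rw [integral_add hfint hgreint, integral_const_mul, integral_const_mul, hgzero, mul_zero,
          add_zero]
end

section
/- Let β : ℝ → ℝ be continuously differentiable with |β'(r)| ≤ 1/4 for all r. Then for every h > 0, every α ≥ 0, and every u ∈ C_c^∞(ℝ, ℂ), ‖h²u''‖_{L²(ℝ)} ≤ 2 ‖−h²u'' + α²e^{−2(r+β(r))}u‖_{L²(ℝ)} + 2h² ‖u‖_{L²(ℝ)}. (Second-derivative elliptic bound for the operator h²D_r² + α²e^{−2(r+β(r))}, uniform in the angular frequency α.) -/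
open MeasureTheory

/-- For `a, b, c` the values of `u, u', u''` and `|V'| ≤ (5/2) V`, the square of `h²u''` is controlled
by the squares of `-h²u'' + Vu` and `2h²u`, up to the derivative of `2h² V Re(u' ū)`. -/
lemma sq_norm_mul_le_sq_norm_add {a b c : ℂ} {h V V' : ℝ} (hV : 0 ≤ V)
    (hV' : |V'| ≤ 5 / 2 * V) :
    ‖(h ^ 2 : ℂ) * c‖ ^ 2 ≤ ‖-(h ^ 2 : ℂ) * c + (V : ℂ) * a‖ ^ 2 + (2 * h ^ 2) ^ 2 * ‖a‖ ^ 2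
      + h ^ 2 * (2 * (V' * inner ℝ a b + V * (inner ℝ a c + inner ℝ b b))) := by
  have hexp : ‖-(h ^ 2 : ℂ) * c + (V : ℂ) * a‖ ^ 2
      = ‖(h ^ 2 : ℂ) * c‖ ^ 2 + V ^ 2 * ‖a‖ ^ 2 - 2 * h ^ 2 * V * inner ℝ a c := by
    have hcast : (h ^ 2 : ℂ) = ((h ^ 2 : ℝ) : ℂ) := by push_cast; rfl
    rw [hcast, ← Complex.normSq_eq_norm_sq, ← Complex.normSq_eq_norm_sq,
      ← Complex.normSq_eq_norm_sq, Complex.inner]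
    simp only [Complex.normSq_apply, Complex.add_re, Complex.add_im, Complex.mul_re,
      Complex.mul_im, Complex.neg_re, Complex.neg_im, Complex.ofReal_re, Complex.ofReal_im,
      Complex.conj_re, Complex.conj_im]
    ring
  rw [hexp, real_inner_self_eq_norm_sq]
  have hcross : -(5 / 2 * V * (‖a‖ * ‖b‖)) ≤ V' * inner ℝ a b := by
    refine (abs_le.mp ?_).1
    rw [abs_mul]
    exact mul_le_mul hV' (abs_real_inner_le_norm a b) (abs_nonneg _) (by positivity)
  have hcross' := mul_le_mul_of_nonneg_left hcross (sq_nonneg h)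
  have hsq : 0 ≤ h ^ 2 * V * (‖b‖ - 5 / 4 * ‖a‖) ^ 2 := by positivity
  have hsq' : 0 ≤ (V - 25 / 16 * h ^ 2) ^ 2 * ‖a‖ ^ 2 := by positivity
  have hrem : 0 ≤ h ^ 4 * ‖a‖ ^ 2 := by positivity
  nlinarith

/-- An `L²` function which is controlled in square mean by two others satisfies the corresponding
bound between the `L²` norms. -/
lemma eLpNorm_two_le_add_of_integral_sq_le {X E : Type*} [MeasurableSpace X] {μ : Measure X}
    [NormedAddCommGroup E] {f g k : X → E} {c : ℝ} (hc : 0 ≤ c)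
    (hf : MemLp f 2 μ) (hg : MemLp g 2 μ) (hk : MemLp k 2 μ)
    (hle : ∫ x, ‖f x‖ ^ 2 ∂μ ≤ ∫ x, ‖g x‖ ^ 2 ∂μ + c ^ 2 * ∫ x, ‖k x‖ ^ 2 ∂μ) :
    eLpNorm f 2 μ ≤ eLpNorm g 2 μ + ENNReal.ofReal c * eLpNorm k 2 μ := by
  have hsqrt {w : X → E} (hw : MemLp w 2 μ) :
      eLpNorm w 2 μ = ENNReal.ofReal √(∫ x, ‖w x‖ ^ 2 ∂μ) := by
    rw [hw.eLpNorm_eq_integral_rpow_norm two_ne_zero ENNReal.ofNat_ne_top, Real.sqrt_eq_rpow]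
    simp
  have hnonneg (w : X → E) : 0 ≤ ∫ x, ‖w x‖ ^ 2 ∂μ := integral_nonneg fun x => by positivity
  rw [hsqrt hf, hsqrt hg, hsqrt hk, ← ENNReal.ofReal_mul hc,
    ← ENNReal.ofReal_add (Real.sqrt_nonneg _) (by positivity)]
  refine ENNReal.ofReal_le_ofReal (Real.sqrt_le_iff.mpr ⟨by positivity, hle.trans ?_⟩)
  have hcross : 0 ≤ √(∫ x, ‖g x‖ ^ 2 ∂μ) * (c * √(∫ x, ‖k x‖ ^ 2 ∂μ)) := by positivity
  nlinarith [Real.sq_sqrt (hnonneg g), Real.sq_sqrt (hnonneg k)]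

/-- Second-derivative elliptic bound for `h²D_r² + α²e^{−2(r+β(r))}`, uniform in `α`:
`‖h²u''‖ ≤ 2‖−h²u'' + α²e^{−2(r+β(r))}u‖ + 2h²‖u‖` for `u ∈ C_c^∞(ℝ, ℂ)`,
assuming `|β'| ≤ 1/4`. -/
theorem second_derivative_elliptic_bound
    (β : ℝ → ℝ) (hβ : ContDiff ℝ 1 β) (hβ' : ∀ r, |deriv β r| ≤ 1 / 4)
    (h α : ℝ) (hh : 0 < h) (hα : 0 ≤ α)
    (u : ℝ → ℂ) (hu : ContDiff ℝ (⊤ : ℕ∞) u) (hsupp : HasCompactSupport u) :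
    eLpNorm (fun r => (h ^ 2 : ℂ) * deriv (deriv u) r) 2 volume ≤
      2 * eLpNorm (fun r =>
            -(h ^ 2 : ℂ) * deriv (deriv u) r
              + ((α ^ 2 * Real.exp (-2 * (r + β r)) : ℝ) : ℂ) * u r) 2 volume
        + ENNReal.ofReal (2 * h ^ 2) * eLpNorm u 2 volume := by
  set V : ℝ → ℝ := fun r => α ^ 2 * Real.exp (-2 * (r + β r)) with hVdef
  set V' : ℝ → ℝ := fun r => -2 * (1 + deriv β r) * V r with hV'def
  have hu' : ContDiff ℝ (⊤ : ℕ∞) (deriv u) := (contDiff_infty_iff_deriv.mp hu).2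
  have hu'' : ContDiff ℝ (⊤ : ℕ∞) (deriv (deriv u)) := (contDiff_infty_iff_deriv.mp hu').2
  have hd (r : ℝ) : HasDerivAt u (deriv u r) r :=
    ((contDiff_infty_iff_deriv.mp hu).1 r).hasDerivAt
  have hd' (r : ℝ) : HasDerivAt (deriv u) (deriv (deriv u) r) r :=
    ((contDiff_infty_iff_deriv.mp hu').1 r).hasDerivAt
  have hs'' : HasCompactSupport (deriv (deriv u)) := hsupp.deriv.deriv
  have hcu := hu.continuous
  have hcu' := hu'.continuous
  have hcu'' := hu''.continuous
  have hcβ := hβ.continuous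
  have hcβ' : Continuous (deriv β) := hβ.continuous_deriv le_rfl
  have hcV : Continuous V := by fun_prop
  have hcV' : Continuous V' := by fun_prop
  have hVd (r : ℝ) : HasDerivAt V (V' r) r := by
    have hβd : HasDerivAt β (deriv β r) r := (hβ.differentiable one_ne_zero r).hasDerivAt
    refine ((((hasDerivAt_id' r).add hβd).const_mul (-2)).exp.const_mul (α ^ 2)).congr_deriv ?_
    simp only [hV'def, hVdef, Pi.add_apply]
    ring
  have hV0 (r : ℝ) : 0 ≤ V r := by positivity
  have hVV' (r : ℝ) : |V' r| ≤ 5 / 2 * V r := by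
    have hb := abs_le.mp (hβ' r)
    rw [hV'def, abs_mul, abs_of_nonneg (hV0 r)]
    exact mul_le_mul_of_nonneg_right (abs_le.mpr ⟨by linarith, by linarith⟩) (hV0 r)
  set G : ℝ → ℝ := fun r => V r * inner ℝ (u r) (deriv u r)
  set G' : ℝ → ℝ := fun r => V' r * inner ℝ (u r) (deriv u r)
    + V r * (inner ℝ (u r) (deriv (deriv u) r) + inner ℝ (deriv u r) (deriv u r))
  have hGd (r : ℝ) : HasDerivAt G (G' r) r := (hVd r).mul ((hd r).inner ℝ (hd' r))
  have hGs : HasCompactSupport G := hsupp.mono fun r hr hur => hr <| by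
    simp only [G, hur, inner_zero_left, mul_zero]
  have hG's : HasCompactSupport G' := by
    rw [← funext fun r => (hGd r).deriv]
    exact hGs.deriv
  have hGi : Integrable G := Continuous.integrable_of_hasCompactSupport (by fun_prop) hGs
  have hG'i : Integrable G' := Continuous.integrable_of_hasCompactSupport (by fun_prop) hG's
  have hG'0 : ∫ r, G' r = 0 := integral_eq_zero_of_hasDerivAt_of_integrable hGd hG'i hGi
  have hmu : MemLp u 2 volume := hcu.memLp_of_hasCompactSupport hsupp
  have hm : MemLp (fun r => (h ^ 2 : ℂ) * deriv (deriv u) r) 2 volume :=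
    (hcu''.memLp_of_hasCompactSupport hs'').const_mul _
  have hVu : MemLp (fun r => ((V r : ℝ) : ℂ) * u r) 2 volume :=
    Continuous.memLp_of_hasCompactSupport (by fun_prop)
      (hsupp.mul_left (f := fun r => ((V r : ℝ) : ℂ)))
  have hmf : MemLp (fun r => -(h ^ 2 : ℂ) * deriv (deriv u) r + ((V r : ℝ) : ℂ) * u r) 2 volume :=
    ((hcu''.memLp_of_hasCompactSupport hs'').const_mul _).add hVu
  have hsq {w : ℝ → ℂ} (hw : MemLp w 2 volume) : Integrable fun r => ‖w r‖ ^ 2 :=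
    hw.integrable_norm_pow two_ne_zero
  have hint := integral_mono (hsq hm)
    (((hsq hmf).add ((hsq hmu).const_mul ((2 * h ^ 2) ^ 2))).add
      ((hG'i.const_mul 2).const_mul (h ^ 2)))
    fun r => sq_norm_mul_le_sq_norm_add (a := u r) (b := deriv u r) (c := deriv (deriv u) r)
      (h := h) (hV0 r) (hVV' r)
  rw [integral_add' ((hsq hmf).add ((hsq hmu).const_mul _))
      ((hG'i.const_mul 2).const_mul (h ^ 2)),
    integral_add' (hsq hmf) ((hsq hmu).const_mul _), integral_const_mul, integral_const_mul,
    integral_const_mul, hG'0, mul_zero, mul_zero, add_zero] at hint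
  refine (eLpNorm_two_le_add_of_integral_sq_le (by positivity) hm hmf hmu hint).trans ?_
  gcongr
  exact le_mul_of_one_le_left' one_le_two
end

section
/- Let β : ℝ → ℝ be continuously differentiable, let σ₀ > 0, let T > 0, and let r, ρ : [0, T] → ℝ be differentiable and satisfy r'(t) = 2ρ(t) and ρ'(t) = 2(1 + β'(r(t))) e^{−2(r(t)+β(r(t)))} σ₀ for all t ∈ [0, T]. Then the energy E(t) = ρ(t)² + e^{−2(r(t)+β(r(t)))} σ₀ is constant on [0, T]; denote its value by E, so E > 0 and |ρ(t)| < √E for all t. Moreover, with arctanh x = (1/2) log((1+x)/(1−x)) for |x| < 1, one has for every t ∈ [0, T]: arctanh(ρ(t)/√E) − arctanh(ρ(0)/√E) = 2√E ( t + ∫₀ᵗ β'(r(s)) ds ). -/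
/-- `arctanh x = (1/2) log((1+x)/(1−x))` for `|x| < 1`. -/
noncomputable def arctanh (x : ℝ) : ℝ := (1 / 2) * Real.log ((1 + x) / (1 - x))

/-- The derivative of `arctanh` on `(-1, 1)`. -/
theorem hasDerivAt_arctanh {x : ℝ} (hx : |x| < 1) : HasDerivAt arctanh (1 / (1 - x ^ 2)) x := by
  obtain ⟨h1, h2⟩ := abs_lt.mp hx
  have hp : 1 + x ≠ 0 := by linarith
  have hm : 1 - x ≠ 0 := by linarith
  have hpm : 1 - x ^ 2 ≠ 0 := by
    rw [show 1 - x ^ 2 = (1 + x) * (1 - x) by ring]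
    exact mul_ne_zero hp hm
  have h := ((((hasDerivAt_id x).const_add 1).div ((hasDerivAt_id x).const_sub 1) hm).log
    (div_ne_zero hp hm)).const_mul (1 / 2 : ℝ)
  refine h.congr_deriv ?_
  simp only [id_eq, Pi.div_apply]
  field_simp
  ring

/-- A function with vanishing derivative on `[0, T]` is constant there. -/
theorem eq_left_of_hasDerivAt_zero {f : ℝ → ℝ} {T : ℝ}
    (hf : ∀ t ∈ Set.Icc (0 : ℝ) T, HasDerivAt f 0 t) : ∀ t ∈ Set.Icc (0 : ℝ) T, f t = f 0 :=
  constant_of_has_deriv_right_zero (fun t ht => (hf t ht).continuousAt.continuousWithinAt)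
    fun t ht => (hf t (Set.Ico_subset_Icc_self ht)).hasDerivWithinAt

/-- Along a bicharacteristic `(r, ρ)` of `p + 1 = ρ² + e^{−2(r+β(r))}σ₀`, the energy
`E(t) = ρ(t)² + e^{−2(r(t)+β(r(t)))}σ₀` is conserved, positive, dominates `ρ(t)²`, and
`arctanh(ρ(t)/√E) − arctanh(ρ(0)/√E) = 2√E (t + ∫₀ᵗ β'(r(s)) ds)`. -/
theorem bicharacteristic_energy_and_arctanh
    (β : ℝ → ℝ) (hβ : ContDiff ℝ 1 β)
    (σ₀ T : ℝ) (hσ₀ : 0 < σ₀) (hT : 0 < T)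
    (r ρ : ℝ → ℝ)
    (hr : ∀ t ∈ Set.Icc (0 : ℝ) T, HasDerivAt r (2 * ρ t) t)
    (hρ : ∀ t ∈ Set.Icc (0 : ℝ) T,
      HasDerivAt ρ (2 * (1 + deriv β (r t)) * Real.exp (-2 * (r t + β (r t))) * σ₀) t)
    (E : ℝ) (hEdef : E = ρ 0 ^ 2 + Real.exp (-2 * (r 0 + β (r 0))) * σ₀) :
    (∀ t ∈ Set.Icc (0 : ℝ) T,
        ρ t ^ 2 + Real.exp (-2 * (r t + β (r t))) * σ₀ = E) ∧
    0 < E ∧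
    (∀ t ∈ Set.Icc (0 : ℝ) T, |ρ t| < Real.sqrt E) ∧
    (∀ t ∈ Set.Icc (0 : ℝ) T,
        arctanh (ρ t / Real.sqrt E) - arctanh (ρ 0 / Real.sqrt E)
          = 2 * Real.sqrt E * (t + ∫ s in (0 : ℝ)..t, deriv β (r s))) := by
  have henergy : ∀ t ∈ Set.Icc (0 : ℝ) T,
      ρ t ^ 2 + Real.exp (-2 * (r t + β (r t))) * σ₀ = E := by
    rw [hEdef]
    refine eq_left_of_hasDerivAt_zero
      (f := fun t => ρ t ^ 2 + Real.exp (-2 * (r t + β (r t))) * σ₀) fun t ht => ?_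
    have hβr : HasDerivAt (fun t => β (r t)) (deriv β (r t) * (2 * ρ t)) t :=
      ((hβ.differentiable one_ne_zero) (r t)).hasDerivAt.comp t (hr t ht)
    refine (((hρ t ht).pow 2).add
      ((((hr t ht).add hβr).const_mul (-2)).exp.mul_const σ₀)).congr_deriv ?_
    simp only [Pi.add_apply]
    push_cast
    ring
  have hE : 0 < E := by
    rw [hEdef]
    positivity
  have hlt : ∀ t ∈ Set.Icc (0 : ℝ) T, |ρ t| < Real.sqrt E := fun t ht => by
    refine Real.lt_sqrt_of_sq_lt ?_
    rw [sq_abs, ← henergy t ht]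
    exact lt_add_of_pos_right _ (by positivity)
  refine ⟨henergy, hE, hlt, fun t ht => ?_⟩
  have hs : 0 < Real.sqrt E := Real.sqrt_pos.mpr hE
  have hsub : Set.uIcc 0 t ⊆ Set.Icc 0 T := by
    rw [Set.uIcc_of_le ht.1]
    exact Set.Icc_subset_Icc_right ht.2
  have hderiv : ∀ u ∈ Set.uIcc 0 t, HasDerivAt (fun u => arctanh (ρ u / Real.sqrt E))
      (2 * Real.sqrt E * (1 + deriv β (r u))) u := fun u hu => by
    have hu' := hsub hu
    have habs : |ρ u / Real.sqrt E| < 1 := by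
      rw [abs_div, abs_of_pos hs, div_lt_one hs]
      exact hlt u hu'
    refine ((hasDerivAt_arctanh habs).comp u ((hρ u hu').div_const _)).congr_deriv ?_
    have hgap : 1 - (ρ u / Real.sqrt E) ^ 2 = Real.exp (-2 * (r u + β (r u))) * σ₀ / E := by
      rw [div_pow, Real.sq_sqrt hE.le, eq_div_iff hE.ne', sub_mul, div_mul_cancel₀ _ hE.ne']
      linarith [henergy u hu']
    rw [hgap]
    field_simp
    rw [Real.sq_sqrt hE.le, mul_comm]
  have hcont : ContinuousOn (fun u => deriv β (r u)) (Set.uIcc 0 t) :=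
    (hβ.continuous_deriv le_rfl).comp_continuousOn fun u hu =>
      (hr u (hsub hu)).continuousAt.continuousWithinAt
  rw [← intervalIntegral.integral_eq_sub_of_hasDerivAt hderiv
    (continuousOn_const.mul (continuousOn_const.add hcont)).intervalIntegrable,
    intervalIntegral.integral_const_mul,
    intervalIntegral.integral_add intervalIntegrable_const hcont.intervalIntegrable]
  simp
end

section
/- Let β : ℝ → ℝ be continuously differentiable with |β'(r)| ≤ 1/4 for all r, let σ₀ > 0, let T > 0, and let r, ρ : [0, T] → ℝ be differentiable and satisfy r'(t) = 2ρ(t) and ρ'(t) = 2(1 + β'(r(t))) e^{−2(r(t)+β(r(t)))} σ₀ for all t ∈ [0, T], with ρ(0) ≥ 0. Let E > 0 be the constant value of ρ(t)² + e^{−2(r(t)+β(r(t)))}σ₀. Then: (i) ρ is strictly increasing on [0, T] (so r is convex: r''(t) = 4(1+β'(r(t)))e^{−2(r(t)+β(r(t)))}σ₀ ≥ 0); and (ii) for every t ∈ (0, T], 2√E ( t + ∫₀ᵗ β'(r(s)) ds ) ≥ (3/4) (r(t) − r(0)) / max_{s ∈ [0,t]} (ρ(s)/√E), where the maximum is strictly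 positive. -/
/-- Quantitative escape estimate (1.4): along a bicharacteristic with `ρ(0) ≥ 0` and
`|β'| ≤ 1/4`, the momentum `ρ` is strictly increasing (so `r` is convex), and for
`t ∈ (0, T]`,
`2√E (t + ∫₀ᵗ β'(r(s)) ds) ≥ (3/4)(r(t) − r(0)) / max_{s∈[0,t]} (ρ(s)/√E)`,
the maximum being strictly positive. -/
theorem bicharacteristic_escape_estimate
    (β : ℝ → ℝ) (hβ : ContDiff ℝ 1 β) (hβ' : ∀ x, |deriv β x| ≤ 1 / 4)
    (σ₀ T : ℝ) (hσ₀ : 0 < σ₀) (hT : 0 < T)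
    (r ρ : ℝ → ℝ)
    (hr : ∀ t ∈ Set.Icc (0 : ℝ) T, HasDerivAt r (2 * ρ t) t)
    (hρ : ∀ t ∈ Set.Icc (0 : ℝ) T,
      HasDerivAt ρ (2 * (1 + deriv β (r t)) * Real.exp (-2 * (r t + β (r t))) * σ₀) t)
    (hρ0 : 0 ≤ ρ 0)
    (E : ℝ) (hE : 0 < E)
    (hEconst : ∀ t ∈ Set.Icc (0 : ℝ) T,
      ρ t ^ 2 + Real.exp (-2 * (r t + β (r t))) * σ₀ = E) :
    StrictMonoOn ρ (Set.Icc 0 T) ∧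
    (∀ t ∈ Set.Icc (0 : ℝ) T,
        0 ≤ 4 * (1 + deriv β (r t)) * Real.exp (-2 * (r t + β (r t))) * σ₀) ∧
    (∀ t ∈ Set.Ioc (0 : ℝ) T,
        0 < sSup ((fun s => ρ s / Real.sqrt E) '' Set.Icc 0 t) ∧
        (3 / 4) * (r t - r 0) / sSup ((fun s => ρ s / Real.sqrt E) '' Set.Icc 0 t)
          ≤ 2 * Real.sqrt E * (t + ∫ s in (0 : ℝ)..t, deriv β (r s))) := by
  have one_add_pos : ∀ x, 0 < 1 + deriv β x := fun x => by linarith [(abs_le.1 (hβ' x)).1]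
  have strictMono : StrictMonoOn ρ (Set.Icc 0 T) := by
    refine strictMonoOn_of_deriv_pos (convex_Icc 0 T)
      (fun t ht => (hρ t ht).continuousAt.continuousWithinAt) fun t ht => ?_
    rw [(hρ t (interior_subset ht)).deriv]
    have := one_add_pos (r t)
    positivity
  refine ⟨strictMono, fun t _ => ?_, fun t ht => ?_⟩
  · have := one_add_pos (r t)
    positivity
  obtain ⟨ht0, htT⟩ := ht
  have subset : Set.Icc 0 t ⊆ Set.Icc 0 T := Set.Icc_subset_Icc_right htT
  have sqrt_pos : 0 < Real.sqrt E := Real.sqrt_pos.2 hE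
  have ρ_pos : 0 < ρ t :=
    hρ0.trans_lt (strictMono ⟨le_rfl, hT.le⟩ ⟨ht0.le, htT⟩ ht0)
  have ρ_le : ∀ s ∈ Set.Icc 0 t, ρ s ≤ ρ t := fun s hs =>
    strictMono.monotoneOn (subset hs) ⟨ht0.le, htT⟩ hs.2
  have sSup_eq : sSup ((fun s => ρ s / Real.sqrt E) '' Set.Icc 0 t) = ρ t / Real.sqrt E := by
    refine IsGreatest.csSup_eq ⟨⟨t, ⟨ht0.le, le_rfl⟩, rfl⟩, ?_⟩
    rintro _ ⟨s, hs, rfl⟩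
    exact div_le_div_of_nonneg_right (ρ_le s hs) sqrt_pos.le
  have r_sub_le : r t - r 0 ≤ 2 * ρ t * (t - 0) := by
    refine (convex_Icc 0 t).image_sub_le_mul_sub_of_deriv_le
      (fun s hs => (hr s (subset hs)).continuousAt.continuousWithinAt)
      (fun s hs => (hr s (subset (interior_subset hs))).differentiableAt.differentiableWithinAt)
      (fun s hs => ?_) 0 ⟨le_rfl, ht0.le⟩ t ⟨ht0.le, le_rfl⟩ ht0.le
    rw [(hr s (subset (interior_subset hs))).deriv]
    linarith [ρ_le s (interior_subset hs)]
  have le_integral : -(1 / 4 * t) ≤ ∫ s in (0 : ℝ)..t, deriv β (r s) := by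
    have := intervalIntegral.norm_integral_le_of_norm_le_const (a := 0) (b := t)
      (f := fun s => deriv β (r s)) fun s _ => hβ' (r s)
    rw [sub_zero, abs_of_pos ht0] at this
    exact (abs_le.1 this).1
  rw [sSup_eq]
  refine ⟨div_pos ρ_pos sqrt_pos, ?_⟩
  calc (3 / 4) * (r t - r 0) / (ρ t / Real.sqrt E)
      ≤ 2 * Real.sqrt E * (3 / 4 * t) := by
        rw [div_le_iff₀ (div_pos ρ_pos sqrt_pos)]
        have : 2 * Real.sqrt E * (3 / 4 * t) * (ρ t / Real.sqrt E) = 3 / 4 * (2 * ρ t * t) := by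
          field_simp
        linarith
    _ ≤ 2 * Real.sqrt E * (t + ∫ s in (0 : ℝ)..t, deriv β (r s)) := by
        gcongr
        linarith
end
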